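/- Let f : ℝ → ℝ be Lipschitz with constant K, let A ∈ ℝ^{N×N} and W ∈ ℝ^{D×D} be matrices, let α > 0, and let C : ℝ^{N×D} → ℝ^{N×D} be a linear map that is Lipschitz with constant α in the Frobenius norm. If K · ‖A‖₂ · α · ‖W‖_F < 1, then the invertible residual block H(X) = X + σ(A · C(X) · W), where σ applies f entrywise, is a bijection of ℝ^{N×D}. -/

import Mathlib

/-- The Frobenius norm of a real matrix. -/
noncomputable def frobNorm {m n : Type*} [Fintype m] [Fintype n] (M : Matrix m n ℝ) : ℝ :=
  Real.sqrt (∑ i, ∑ j, (M i j) ^ 2)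

/-- The ℓ²-operator (spectral) norm of a real square matrix. -/
noncomputable def specNorm {n : ℕ} (A : Matrix (Fin n) (Fin n) ℝ) : ℝ :=
  ‖Matrix.toEuclideanCLM (𝕜 := ℝ) A‖

/-- A contractive perturbation of the identity of a complete normed group is bijective. -/
theorem ContractingWith.bijective_id_add {E : Type*} [NormedAddCommGroup E] [CompleteSpace E]
    {c : NNReal} {g : E → E} (hg : ContractingWith c g) :
    Function.Bijective (fun x => x + g x) := by
  have hsub (y : E) : ContractingWith c (fun x => y - g x) :=
    ⟨hg.1, LipschitzWith.of_dist_le_mul fun a b => by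
      rw [dist_sub_left]
      exact hg.2.dist_le_mul a b⟩
  refine ⟨fun a b hab => ?_, fun y => ?_⟩
  · refine (hsub (a + g a)).fixedPoint_unique' (x := a) (y := b) ?_ ?_
    · simp [Function.IsFixedPt]
    · change a + g a - g b = b
      rw [sub_eq_iff_eq_add]
      exact hab
  · exact ⟨_, (sub_eq_iff_eq_add.1 (hsub y).fixedPoint_isFixedPt).symm⟩

section Frobenius

variable {l m n : Type*} [Fintype l] [Fintype m] [Fintype n]

attribute [local instance] Matrix.frobeniusNormedAddCommGroup Matrix.frobeniusNormedSpace

theorem frobNorm_eq_norm (M : Matrix m n ℝ) : frobNorm M = ‖M‖ := by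
  simp [frobNorm, Matrix.frobenius_norm_def, Real.sqrt_eq_rpow]

theorem frobNorm_nonneg (M : Matrix m n ℝ) : 0 ≤ frobNorm M :=
  Real.sqrt_nonneg _

theorem frobNorm_mul_le (A : Matrix l m ℝ) (B : Matrix m n ℝ) :
    frobNorm (A * B) ≤ frobNorm A * frobNorm B := by
  simpa only [frobNorm_eq_norm] using Matrix.frobenius_norm_mul A B

theorem frobNorm_sq (M : Matrix m n ℝ) :
    frobNorm M ^ 2 = ∑ j, ‖WithLp.toLp 2 (fun i => M i j)‖ ^ 2 := by
  rw [frobNorm, Real.sq_sqrt (by positivity), Finset.sum_comm]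
  simp [EuclideanSpace.norm_sq_eq]

/-- The Frobenius norm of a product is bounded by the spectral norm of the left factor. -/
theorem frobNorm_mul_le_specNorm {N : ℕ} (A : Matrix (Fin N) (Fin N) ℝ)
    (B : Matrix (Fin N) n ℝ) : frobNorm (A * B) ≤ specNorm A * frobNorm B := by
  have hA : 0 ≤ specNorm A := norm_nonneg _
  refine le_of_sq_le_sq ?_ (mul_nonneg hA (frobNorm_nonneg B))
  rw [mul_pow, frobNorm_sq, frobNorm_sq, Finset.mul_sum]
  refine Finset.sum_le_sum fun j _ => ?_
  rw [← mul_pow]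
  gcongr
  exact (Matrix.toEuclideanCLM (𝕜 := ℝ) A).le_opNorm (WithLp.toLp 2 fun i => B i j)

/-- Applying a Lipschitz function entrywise is Lipschitz in the Frobenius norm. -/
theorem frobNorm_map_sub_map_le {f : ℝ → ℝ} {K : ℝ} (hK : 0 ≤ K)
    (hf : ∀ a b : ℝ, |f a - f b| ≤ K * |a - b|) (X Y : Matrix m n ℝ) :
    frobNorm (X.map f - Y.map f) ≤ K * frobNorm (X - Y) := by
  rw [frobNorm, frobNorm, ← Real.sqrt_sq hK, ← Real.sqrt_mul (sq_nonneg K)]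
  refine Real.sqrt_le_sqrt ?_
  simp only [Finset.mul_sum]
  refine Finset.sum_le_sum fun i _ => Finset.sum_le_sum fun j _ => ?_
  rw [← sq_abs, ← sq_abs ((X - Y) i j), ← mul_pow]
  gcongr
  exact hf _ _

/-- A map of matrices that contracts the Frobenius norm perturbs the identity to a bijection. -/
theorem bijective_id_add_of_frobNorm_le {c : ℝ} (hc0 : 0 ≤ c) (hc1 : c < 1)
    {g : Matrix m n ℝ → Matrix m n ℝ}
    (hg : ∀ X Y, frobNorm (g X - g Y) ≤ c * frobNorm (X - Y)) :
    Function.Bijective (fun X => X + g X) := by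
  have : CompleteSpace (Matrix m n ℝ) := FiniteDimensional.complete ℝ _
  refine ContractingWith.bijective_id_add (c := ⟨c, hc0⟩)
    ⟨hc1, LipschitzWith.of_dist_le_mul fun X Y => ?_⟩
  rw [dist_eq_norm, dist_eq_norm, ← frobNorm_eq_norm, ← frobNorm_eq_norm]
  exact hg X Y

end Frobenius

/-- If `K · ‖A‖₂ · α · ‖W‖_F < 1`, the residual block `H(X) = X + σ(A · C(X) · W)` is a
bijection of `ℝ^{N×D}` (`σ` applies a `K`-Lipschitz scalar function entrywise and `C` is
an `α`-Lipschitz linear map). -/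
theorem stmt_17 {N D : ℕ} (f : ℝ → ℝ) (K : ℝ)
    (hf : ∀ a b : ℝ, |f a - f b| ≤ K * |a - b|)
    (A : Matrix (Fin N) (Fin N) ℝ) (W : Matrix (Fin D) (Fin D) ℝ)
    (α : ℝ) (hα : 0 < α)
    (C : Matrix (Fin N) (Fin D) ℝ →ₗ[ℝ] Matrix (Fin N) (Fin D) ℝ)
    (hC : ∀ X₁ X₂ : Matrix (Fin N) (Fin D) ℝ,
      frobNorm (C X₁ - C X₂) ≤ α * frobNorm (X₁ - X₂))
    (hcontr : K * specNorm A * α * frobNorm W < 1) :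
    Function.Bijective (fun X : Matrix (Fin N) (Fin D) ℝ => X + (A * C X * W).map f) := by
  have hK : 0 ≤ K := by simpa using (abs_nonneg _).trans (hf 1 0)
  have hA : 0 ≤ specNorm A := norm_nonneg _
  have hW : 0 ≤ frobNorm W := frobNorm_nonneg W
  refine bijective_id_add_of_frobNorm_le (by positivity) hcontr fun X Y => ?_
  calc frobNorm ((A * C X * W).map f - (A * C Y * W).map f)
      ≤ K * frobNorm (A * (C X - C Y) * W) := by
        rw [Matrix.mul_sub, Matrix.sub_mul]
        exact frobNorm_map_sub_map_le hK hf _ _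
    _ ≤ K * (specNorm A * (α * frobNorm (X - Y)) * frobNorm W) := by
        gcongr
        refine (frobNorm_mul_le _ _).trans ?_
        gcongr
        refine (frobNorm_mul_le_specNorm _ _).trans ?_
        gcongr
        exact hC X Y
    _ = K * specNorm A * α * frobNorm W * frobNorm (X - Y) := by ring
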